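/- arXiv:1702.01377 — 2 statements merged into one kernel-verified Lean document; each statement's English description precedes it below -/
import Mathlib

section
/- Let k=(k_1,…,k_r) be a nonempty index of weight k=wt(k), and let N≥1 be an integer. Then S⋆(k,N) equals the iterated integral S⋆(k,N) = ∫_{Δ(k)} ω_{δ(1)}(t_1)⋯ω_{δ(k−1)}(t_{k−1}) · (1−t_k^N)/(1−t_k) dt_k, where ω_0(t)=dt/t, ω_1(t)=dt/(1−t), and δ(j)=1 if j∈A(k), δ(j)=0 otherwise. -/
open MeasureTheory Filter Topology

namespace Kawashima

/-- The set `A(k) = {k₁, k₁+k₂, …, k₁+⋯+k_{r-1}}` of proper nonempty partial sums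
of an index `k = (k₁, …, k_r)`. -/
def Aset (k : List ℕ) : Finset ℕ :=
  (Finset.Ico 1 k.length).image (fun i => (k.take i).sum)

/-- The Hoffman dual of an index `k`: the unique index `k∨` with the same weight such
that `A(k)` and `A(k∨)` partition `{1, …, wt(k) - 1}`.  It is computed here as the
composition of `wt(k)` whose partial-sum set is the complement of `A(k)`. -/
def hdual (k : List ℕ) : List ℕ :=
  let w := k.sum
  let L := (insert w ((Finset.Icc 1 (w - 1)) \ Aset k)).sort (· ≤ ·)
  L.zipWith (fun a b => a - b) (0 :: L)

/-- `sStar k N = s⋆(k, N) = Σ_{0 < m₁ ≤ ⋯ ≤ m_{r-1} ≤ m_r = N} 1/(m₁^{k₁} ⋯ m_r^{k_r})`.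
For the empty index the value is `1` (empty product), and for a nonempty index and
`N = 0` the value is `0` (empty sum). -/
noncomputable def sStar (k : List ℕ) (N : ℕ) : ℝ :=
  ∑ m : Fin k.length → Fin (N + 1),
    if (∀ i, 0 < (m i : ℕ)) ∧
       (∀ i j : Fin k.length, i ≤ j → (m i : ℕ) ≤ (m j : ℕ)) ∧
       (∀ i : Fin k.length, (i : ℕ) + 1 = k.length → (m i : ℕ) = N)
    then ∏ i : Fin k.length, 1 / ((m i : ℕ) : ℝ) ^ k.get i
    else 0

/-- `SStar k N = S⋆(k, N) = Σ_{n=1}^N s⋆(k, n)`. -/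
noncomputable def SStar (k : List ℕ) (N : ℕ) : ℝ :=
  ∑ n ∈ Finset.Icc 1 N, sStar k n

/-- The binomial coefficient `binom(z, n) = z(z-1)⋯(z-n+1)/n!` for complex `z`. -/
noncomputable def cbinom (z : ℂ) (n : ℕ) : ℂ :=
  (descPochhammer ℂ n).eval z / (n.factorial : ℂ)

/-- The Kawashima function
`F_k(z) = Σ_{n=1}^∞ (-1)^{n-1} s⋆(k∨, n) binom(z, n)`, with `F_∅(z) = 1`. -/
noncomputable def F (k : List ℕ) (z : ℂ) : ℂ :=
  if k = [] then 1
  else ∑' n : ℕ, (-1 : ℂ) ^ n * ((sStar (hdual k) (n + 1) : ℝ) : ℂ) * cbinom z (n + 1)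

/-- The domain `Δ(k) ⊆ (0,1)^{wt(k)}`: `t_j < t_{j+1}` if `j ∈ A(k)` and
`t_j > t_{j+1}` otherwise (positions `1`-indexed). -/
def Delta (k : List ℕ) : Set (Fin k.sum → ℝ) :=
  {t | (∀ j, t j ∈ Set.Ioo (0 : ℝ) 1) ∧
       ∀ (i : Fin k.sum) (h : (i : ℕ) + 1 < k.sum),
         if (i : ℕ) + 1 ∈ Aset k then t i < t ⟨(i : ℕ) + 1, h⟩
         else t ⟨(i : ℕ) + 1, h⟩ < t i}

/-- The multiple zeta value `ζ(k) = Σ_{0 < m₁ < ⋯ < m_r} 1/(m₁^{k₁} ⋯ m_r^{k_r})`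
(as a `tsum`; it converges for admissible `k`), with `ζ(∅) = 1`. -/
noncomputable def mzv (k : List ℕ) : ℝ :=
  ∑' m : Fin k.length → ℕ,
    if (∀ i, 0 < m i) ∧ (∀ i j : Fin k.length, i < j → m i < m j)
    then ∏ i : Fin k.length, 1 / ((m i : ℕ) : ℝ) ^ k.get i
    else 0

/-- `ζ` extended `ℚ`-linearly to formal `ℚ`-linear combinations of indices. -/
noncomputable def zetaL (v : List ℕ →₀ ℚ) : ℝ :=
  v.sum fun k a => (a : ℝ) * mzv k

/-- The Kawashima function extended `ℚ`-linearly to formal combinations of indices. -/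
noncomputable def FL (v : List ℕ →₀ ℚ) (z : ℂ) : ℂ :=
  v.sum fun k a => (a : ℂ) * F k z

/-- Auxiliary harmonic product, on *reversed* indices (so that the rightmost entry of
the index is the head of the list):
`k * l = (k₋ * l, k_r) + (k * l₋, l_s) + (k₋ * l₋, k_r + l_s)`. -/
noncomputable def hstarAux : List ℕ → List ℕ → (List ℕ →₀ ℚ)
  | [], l => Finsupp.single l 1
  | a :: k, [] => Finsupp.single (a :: k) 1
  | a :: k, b :: l =>
      Finsupp.mapDomain (List.cons a) (hstarAux k (b :: l)) +
      Finsupp.mapDomain (List.cons b) (hstarAux (a :: k) l) +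
      Finsupp.mapDomain (List.cons (a + b)) (hstarAux k l)
  termination_by k l => k.length + l.length

/-- The harmonic product `k * l` of two indices, as a `ℚ`-linear combination of
indices. -/
noncomputable def hstar (k l : List ℕ) : List ℕ →₀ ℚ :=
  Finsupp.mapDomain List.reverse (hstarAux k.reverse l.reverse)

/-- Auxiliary product `*̄` on reversed indices:
`k *̄ l = (k₋ *̄ l, k_r) + (k *̄ l₋, l_s) - (k₋ *̄ l₋, k_r + l_s)`. -/
noncomputable def hbarAux : List ℕ → List ℕ → (List ℕ →₀ ℚ)
  | [], l => Finsupp.single l 1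
  | a :: k, [] => Finsupp.single (a :: k) 1
  | a :: k, b :: l =>
      Finsupp.mapDomain (List.cons a) (hbarAux k (b :: l)) +
      Finsupp.mapDomain (List.cons b) (hbarAux (a :: k) l) -
      Finsupp.mapDomain (List.cons (a + b)) (hbarAux k l)
  termination_by k l => k.length + l.length

/-- The harmonic product `k *̄ l` of two indices. -/
noncomputable def hbar (k l : List ℕ) : List ℕ →₀ ℚ :=
  Finsupp.mapDomain List.reverse (hbarAux k.reverse l.reverse)

/-- The product `k ⊛ l = (k₋ * l₋, k_r + l_s)` for nonempty indices `k`, `l`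
(and `0` if either is empty). -/
noncomputable def circAst (k l : List ℕ) : List ℕ →₀ ℚ :=
  match k.reverse, l.reverse with
  | a :: k', b :: l' =>
      Finsupp.mapDomain List.reverse
        (Finsupp.mapDomain (List.cons (a + b)) (hstarAux k' l'))
  | _, _ => 0

/-- `⊛` extended bilinearly to formal combinations. -/
noncomputable def circAstL (v w : List ℕ →₀ ℚ) : List ℕ →₀ ℚ :=
  v.sum fun k a => w.sum fun l b => (a * b) • circAst k l

/-- The star operator `k ↦ k⋆`: the sum over all ways to replace commas by pluses
in groups of consecutive entries,
`(k₁,…,k_r)⋆ = Σ_{0<j₁<⋯<j_q=r} (k₁+⋯+k_{j₁}, …, k_{j_{q-1}+1}+⋯+k_{j_q})`. -/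
noncomputable def starOp : List ℕ → (List ℕ →₀ ℚ)
  | [] => Finsupp.single [] 1
  | [a] => Finsupp.single [a] 1
  | a :: b :: k =>
      Finsupp.mapDomain (List.cons a) (starOp (b :: k)) + starOp ((a + b) :: k)
  termination_by k => k.length

/-- The star operator extended `ℚ`-linearly. -/
noncomputable def starL (v : List ℕ →₀ ℚ) : List ℕ →₀ ℚ :=
  v.sum fun k a => a • starOp k

open Classical in
/-- Kawashima's function `G_k(z)`: the sum over tuples `0 < n₁, …, n_w` with
`n_j < n_{j+1}` if `j ∉ A(k)` and `n_j ≤ n_{j+1}` if `j ∈ A(k)`, of the product of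
the factors `1/(n_j + z)` at positions `j ∈ A(k)`, the factor
`1/n_w - 1/(n_w + z)` at the last position, and `1/n_j` elsewhere. -/
noncomputable def G (k : List ℕ) (z : ℂ) : ℂ :=
  ∑' n : Fin k.sum → ℕ,
    if (∀ j, 0 < n j) ∧
       (∀ (i : Fin k.sum) (h : (i : ℕ) + 1 < k.sum),
          if (i : ℕ) + 1 ∈ Aset k then n i ≤ n ⟨(i : ℕ) + 1, h⟩
          else n i < n ⟨(i : ℕ) + 1, h⟩)
    then ∏ j : Fin k.sum,
      if (j : ℕ) + 1 = k.sum then 1 / ((n j : ℕ) : ℂ) - 1 / (((n j : ℕ) : ℂ) + z)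
      else if (j : ℕ) + 1 ∈ Aset k then 1 / (((n j : ℕ) : ℂ) + z)
      else 1 / ((n j : ℕ) : ℂ)
    else 0

open Classical in
/-- `ζ_k(l) = Σ 1/(n₁^{l₁} ⋯ n_w^{l_w})`, summed over the same set of tuples as in
the definition of `G_k`. -/
noncomputable def zetaIdx (k : List ℕ) (l : List ℕ) : ℝ :=
  ∑' n : Fin k.sum → ℕ,
    if (∀ j, 0 < n j) ∧
       (∀ (i : Fin k.sum) (h : (i : ℕ) + 1 < k.sum),
          if (i : ℕ) + 1 ∈ Aset k then n i ≤ n ⟨(i : ℕ) + 1, h⟩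
          else n i < n ⟨(i : ℕ) + 1, h⟩)
    then ∏ j : Fin k.sum, 1 / ((n j : ℕ) : ℝ) ^ (l.getD (j : ℕ) 0)
    else 0

/-- `C_m(k) = Σ_{l₁,…,l_{r-1} ≥ 0, l_r ≥ 1, l₁+⋯+l_r = m}
ζ_k(1,…,1 (k₁-1 ones), l₁+1, …, 1,…,1 (k_r-1 ones), l_r+1)`. -/
noncomputable def Cm (k : List ℕ) (m : ℕ) : ℝ :=
  ∑ l : Fin k.length → Fin (m + 1),
    if (∑ i, (l i : ℕ)) = m ∧
       (∀ i : Fin k.length, (i : ℕ) + 1 = k.length → 1 ≤ (l i : ℕ))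
    then zetaIdx k
      ((List.ofFn (fun i : Fin k.length =>
          List.replicate (k.get i - 1) 1 ++ [(l i : ℕ) + 1])).flatten)
    else 0

/-- The iterated integral `A_m(k)` over `Δ((k,1,…,1))` (`m` trailing ones) of
`ω_{δ(1)}(t₁) ⋯ ω_{δ(w-1)}(t_{w-1}) · dt_w/(1-t_w) · dt_{w+1}/t_{w+1} ⋯ dt_{w+m}/t_{w+m}`. -/
noncomputable def Aint (k : List ℕ) (m : ℕ) : ℝ :=
  ∫ t in Delta (k ++ List.replicate m 1),
    ∏ i : Fin (k ++ List.replicate m 1).sum,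
      if (i : ℕ) + 1 < k.sum then
        (if (i : ℕ) + 1 ∈ Aset k then 1 / (1 - t i) else 1 / t i)
      else if (i : ℕ) + 1 = k.sum then 1 / (1 - t i)
      else 1 / t i

/-- The digamma function `ψ(z) = Γ'(z)/Γ(z)`. -/
noncomputable def digamma (z : ℂ) : ℂ := deriv Complex.Gamma z / Complex.Gamma z


/-- The points of `(0,1)^w` with `t_j < t_{j+1}` if `j ∈ A` and `t_{j+1} < t_j` otherwise
(positions `1`-indexed). -/
def chain (A : Finset ℕ) (w : ℕ) : Set (Fin w → ℝ) :=
  {t | (∀ j, t j ∈ Set.Ioo (0 : ℝ) 1) ∧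
       ∀ (i : Fin w) (h : (i : ℕ) + 1 < w),
         if (i : ℕ) + 1 ∈ A then t i < t ⟨(i : ℕ) + 1, h⟩
         else t ⟨(i : ℕ) + 1, h⟩ < t i}

/-- The density of the form `ω_{δ(j)}` at position `j`. -/
noncomputable def density (A : Finset ℕ) (j : ℕ) (s : ℝ) : ℝ :=
  if j ∈ A then 1 / (1 - s) else 1 / s

/-- The values allowed at position `j + 1` when position `j` has the value `s`. -/
def nextSet (A : Finset ℕ) (j : ℕ) (s : ℝ) : Set ℝ :=
  if j ∈ A then Set.Ioo s 1 else Set.Ioo 0 s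

/-- The effect on the coefficients of a polynomial of degree `< N` of integrating over
`nextSet A j s` and multiplying by `density A j s`. -/
noncomputable def coeffStep (A : Finset ℕ) (N j : ℕ) (c : ℕ → ℝ) (m : ℕ) : ℝ :=
  if j ∈ A then ∑ n ∈ Finset.Ico m N, c n / (n + 1) else c m / (m + 1)

/-- The iterated integral over `chain A (n + 1)` of the polynomial with coefficients `c`,
in terms of the coefficients. -/
noncomputable def coeffIter (A : Finset ℕ) (N : ℕ) : ℕ → (ℕ → ℝ) → ℝ
  | 0, c => ∑ n ∈ Finset.range N, c n / (n + 1)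
  | j + 1, c => coeffIter A N j (coeffStep A N (j + 1) c)

/-- The polynomial function of degree `< N` with coefficients `c`. -/
def polyFun (N : ℕ) (c : ℕ → ℝ) (s : ℝ) : ℝ := ∑ n ∈ Finset.range N, c n * s ^ n

lemma continuous_polyFun (N : ℕ) (c : ℕ → ℝ) : Continuous (polyFun N c) := by
  unfold polyFun; fun_prop

lemma polyFun_nonneg {N : ℕ} {c : ℕ → ℝ} (hc : ∀ n, 0 ≤ c n) {s : ℝ} (hs : 0 ≤ s) :
    0 ≤ polyFun N c s :=
  Finset.sum_nonneg fun n _ => mul_nonneg (hc n) (pow_nonneg hs n)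

lemma coeffStep_nonneg (A : Finset ℕ) (N j : ℕ) {c : ℕ → ℝ} (hc : ∀ n, 0 ≤ c n) (m : ℕ) :
    0 ≤ coeffStep A N j c m := by
  have h : ∀ n : ℕ, 0 ≤ c n / ((n : ℝ) + 1) := fun n => div_nonneg (hc n) (by positivity)
  unfold coeffStep
  split_ifs
  · exact Finset.sum_nonneg fun n _ => h n
  · exact h m

lemma lintegral_Ioo_polyFun (N : ℕ) {c : ℕ → ℝ} (hc : ∀ n, 0 ≤ c n) {a b : ℝ} (ha : 0 ≤ a)
    (hab : a ≤ b) :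
    ∫⁻ u in Set.Ioo a b, ENNReal.ofReal (polyFun N c u) =
      ENNReal.ofReal (∑ n ∈ Finset.range N, c n / (n + 1) * (b ^ (n + 1) - a ^ (n + 1))) := by
  rw [← ofReal_integral_eq_lintegral_ofReal
    (((continuous_polyFun N c).integrableOn_Icc (a := a) (b := b)).mono_set
      Set.Ioo_subset_Icc_self)
    (ae_restrict_of_forall_mem measurableSet_Ioo fun u hu =>
      polyFun_nonneg hc (ha.trans hu.1.le)),
    ← integral_Ioc_eq_integral_Ioo, ← intervalIntegral.integral_of_le hab]
  unfold polyFun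
  rw [intervalIntegral.integral_finsetSum
    (fun n _ => (by fun_prop : Continuous _).intervalIntegrable _ _)]
  congr 1
  refine Finset.sum_congr rfl fun n _ => ?_
  rw [intervalIntegral.integral_const_mul, integral_pow]
  ring

lemma sum_Ico_mul_pow (N : ℕ) (d : ℕ → ℝ) {s : ℝ} (hs : s < 1) :
    ∑ m ∈ Finset.range N, (∑ n ∈ Finset.Ico m N, d n) * s ^ m =
      1 / (1 - s) * ∑ n ∈ Finset.range N, d n * (1 - s ^ (n + 1)) := by
  have h : (1 : ℝ) - s ≠ 0 := by linarith
  simp_rw [Finset.sum_mul, Finset.mul_sum]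
  rw [Finset.sum_comm' (t' := Finset.range N) (s' := fun n => Finset.range (n + 1))
    (by intro x y; simp only [Finset.mem_range, Finset.mem_Ico]; omega)]
  refine Finset.sum_congr rfl fun n _ => ?_
  rw [← Finset.mul_sum, ← mul_neg_geom_sum]
  field_simp

lemma density_mul_lintegral_polyFun (A : Finset ℕ) (N j : ℕ) {c : ℕ → ℝ} (hc : ∀ n, 0 ≤ c n)
    {s : ℝ} (hs : s ∈ Set.Ioo (0 : ℝ) 1) :
    ENNReal.ofReal (density A j s) * ∫⁻ u in nextSet A j s, ENNReal.ofReal (polyFun N c u) =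
      ENNReal.ofReal (polyFun N (coeffStep A N j c) s) := by
  obtain ⟨h0, h1⟩ := hs
  have h1' : 0 ≤ 1 - s := by linarith
  unfold density nextSet coeffStep
  split_ifs
  · rw [lintegral_Ioo_polyFun N hc h0.le h1.le, ← ENNReal.ofReal_mul (by positivity),
      polyFun, sum_Ico_mul_pow N _ h1]
    simp
  · rw [lintegral_Ioo_polyFun N hc le_rfl h0.le, ← ENNReal.ofReal_mul (by positivity),
      polyFun, Finset.mul_sum]
    congr 1
    refine Finset.sum_congr rfl fun n _ => ?_
    field_simp
    simp
    ring

lemma measurable_density (A : Finset ℕ) (j : ℕ) : Measurable (density A j) := by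
  unfold density
  split_ifs <;> fun_prop

lemma measurableSet_chain (A : Finset ℕ) (w : ℕ) : MeasurableSet (chain A w) := by
  unfold chain
  simp only [Set.ofPred_and, Set.ofPred_forall]
  refine (MeasurableSet.iInter fun j => measurable_pi_apply j measurableSet_Ioo).inter
    (MeasurableSet.iInter fun i => MeasurableSet.iInter fun h => ?_)
  split_ifs
  · exact measurableSet_lt (measurable_pi_apply _) (measurable_pi_apply _)
  · exact measurableSet_lt (measurable_pi_apply _) (measurable_pi_apply _)

lemma snoc_mem_chain {A : Finset ℕ} {n : ℕ} (t : Fin (n + 1) → ℝ) (u : ℝ) :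
    (Fin.snoc t u : Fin (n + 2) → ℝ) ∈ chain A (n + 2) ↔
      t ∈ chain A (n + 1) ∧ u ∈ nextSet A (n + 1) (t (Fin.last n)) := by
  have key : ∀ (i : Fin (n + 1)) (h : (i : ℕ) + 1 < n + 1),
      (Fin.snoc t u : Fin (n + 2) → ℝ) ⟨(i : ℕ) + 1, by omega⟩ = t ⟨(i : ℕ) + 1, h⟩ := fun i h =>
    Fin.snoc_castSucc (α := fun _ => ℝ) u t ⟨(i : ℕ) + 1, h⟩
  have keyl : (Fin.snoc t u : Fin (n + 2) → ℝ) ⟨n + 1, by omega⟩ = u :=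
    Fin.snoc_last (α := fun _ => ℝ) u t
  unfold chain nextSet
  constructor
  · rintro ⟨h1, h2⟩
    have hu := h1 (Fin.last _)
    rw [Fin.snoc_last] at hu
    have ht : ∀ j, t j ∈ Set.Ioo (0 : ℝ) 1 := fun j => by
      have := h1 j.castSucc
      rwa [Fin.snoc_castSucc] at this
    refine ⟨⟨ht, fun i h => ?_⟩, ?_⟩
    · have := h2 i.castSucc (by simp; omega)
      simp only [Fin.val_castSucc, Fin.snoc_castSucc, key i h] at this
      exact this
    · have := h2 (Fin.last n).castSucc (by simp)
      simp only [Fin.val_castSucc, Fin.snoc_castSucc, Fin.val_last, keyl] at this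
      split_ifs at this ⊢
      · exact ⟨this, hu.2⟩
      · exact ⟨hu.1, this⟩
  · rintro ⟨⟨h1, h2⟩, h3⟩
    have hl := h1 (Fin.last n)
    have hu : u ∈ Set.Ioo (0 : ℝ) 1 := by
      split_ifs at h3
      · exact ⟨hl.1.trans h3.1, h3.2⟩
      · exact ⟨h3.1, h3.2.trans hl.2⟩
    refine ⟨fun j => ?_, fun i h => ?_⟩
    · refine Fin.lastCases ?_ (fun j => ?_) j
      · rwa [Fin.snoc_last]
      · rw [Fin.snoc_castSucc]
        exact h1 j
    · obtain ⟨i, rfl⟩ : ∃ i' : Fin (n + 1), i = i'.castSucc := ⟨⟨i, by omega⟩, rfl⟩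
      simp only [Fin.val_castSucc, Fin.snoc_castSucc] at h ⊢
      by_cases hi : (i : ℕ) + 1 < n + 1
      · rw [key i hi]
        exact h2 i hi
      · obtain rfl : i = Fin.last n := Fin.ext (by simp; omega)
        simp only [Fin.val_last, keyl]
        split_ifs at h3 ⊢
        · exact h3.1
        · exact h3.2

lemma lintegral_chain_succ (A : Finset ℕ) (n : ℕ) {g : ℝ → ENNReal} (hg : Measurable g) :
    ∫⁻ t in chain A (n + 2), (∏ i : Fin (n + 1), ENNReal.ofReal (density A (i + 1) (t i.castSucc)))
        * g (t (Fin.last (n + 1))) =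
      ∫⁻ t in chain A (n + 1), (∏ i : Fin n, ENNReal.ofReal (density A (i + 1) (t i.castSucc)))
        * (ENNReal.ofReal (density A (n + 1) (t (Fin.last n))) *
          ∫⁻ u in nextSet A (n + 1) (t (Fin.last n)), g u) := by
  have hd := measurable_density A
  have hF : Measurable fun t : Fin (n + 2) → ℝ =>
      (∏ i : Fin (n + 1), ENNReal.ofReal (density A (i + 1) (t i.castSucc)))
        * g (t (Fin.last (n + 1))) := by
    refine Measurable.mul (Finset.measurable_prod _ fun i _ => ?_) (hg.comp (measurable_pi_apply _))
    exact ((hd _).comp (measurable_pi_apply _)).ennreal_ofReal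
  have he := (volume_preserving_piFinSuccAbove (fun _ : Fin (n + 2) => ℝ) (Fin.last (n + 1))).symm
  have hI := hF.indicator (measurableSet_chain A (n + 2))
  rw [← lintegral_indicator (measurableSet_chain A (n + 2)),
    ← lintegral_indicator (measurableSet_chain A (n + 1)),
    ← he.lintegral_comp hI, Measure.volume_eq_prod, lintegral_prod_symm' _
      (by exact hI.comp he.measurable)]
  refine lintegral_congr fun t => ?_
  have hs : ∀ u : ℝ, (MeasurableEquiv.piFinSuccAbove (fun _ : Fin (n + 2) => ℝ)
      (Fin.last (n + 1))).symm (u, t) = Fin.snoc t u := fun u => Fin.insertNth_last' u t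
  have hm : MeasurableSet (nextSet A (n + 1) (t (Fin.last n))) := by
    unfold nextSet; split_ifs <;> exact measurableSet_Ioo
  simp only [hs]
  by_cases ht : t ∈ chain A (n + 1)
  · rw [Set.indicator_of_mem ht, ← mul_assoc, ← lintegral_indicator hm,
      ← lintegral_const_mul _ (hg.indicator hm)]
    refine lintegral_congr fun u => ?_
    by_cases hu : u ∈ nextSet A (n + 1) (t (Fin.last n))
    · rw [Set.indicator_of_mem ((snoc_mem_chain t u).2 ⟨ht, hu⟩), Set.indicator_of_mem hu,
        Fin.prod_univ_castSucc]
      simp only [Fin.snoc_castSucc, Fin.snoc_last, Fin.val_castSucc, Fin.val_last]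
    · rw [Set.indicator_of_notMem fun h => hu ((snoc_mem_chain t u).1 h).2,
        Set.indicator_of_notMem hu, mul_zero]
  · rw [Set.indicator_of_notMem ht]
    simp only [Set.indicator_of_notMem fun h => ht ((snoc_mem_chain t _).1 h).1, lintegral_zero]

lemma chain_one (A : Finset ℕ) : chain A 1 = (fun t => t 0) ⁻¹' Set.Ioo (0 : ℝ) 1 := by
  ext t
  simp only [chain, Set.mem_ofPred_eq, Set.mem_preimage, Fin.forall_fin_one]
  exact ⟨fun h => h.1, fun h => ⟨h, fun h' => absurd h' (by simp)⟩⟩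

lemma lintegral_chain_polyFun (A : Finset ℕ) (N n : ℕ) {c : ℕ → ℝ} (hc : ∀ n, 0 ≤ c n) :
    ∫⁻ t in chain A (n + 1), (∏ i : Fin n, ENNReal.ofReal (density A (i + 1) (t i.castSucc)))
        * ENNReal.ofReal (polyFun N c (t (Fin.last n))) =
      ENNReal.ofReal (coeffIter A N n c) := by
  induction n generalizing c with
  | zero =>
    have h := (volume_preserving_funUnique (Fin 1) ℝ).setLIntegral_comp_preimage_emb
      (MeasurableEquiv.measurableEmbedding _) (fun u => ENNReal.ofReal (polyFun N c u))
      (Set.Ioo 0 1)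
    rw [lintegral_Ioo_polyFun N hc le_rfl zero_le_one] at h
    rw [chain_one]
    simp only [coeffIter, Finset.prod_of_isEmpty, one_mul]
    convert h using 1
    · simp only [MeasurableEquiv.funUnique_apply]
      congr!
    · simp
  | succ n ih =>
    rw [lintegral_chain_succ A n (g := fun u => ENNReal.ofReal (polyFun N c u))
      (continuous_polyFun N c).measurable.ennreal_ofReal,
      coeffIter, ← ih (coeffStep_nonneg A N (n + 1) hc)]
    refine setLIntegral_congr_fun (measurableSet_chain A (n + 1)) fun t ht => ?_
    simp only [density_mul_lintegral_polyFun A N (n + 1) hc (ht.1 (Fin.last n))]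

lemma coeffIter_nonneg (A : Finset ℕ) (N n : ℕ) {c : ℕ → ℝ} (hc : ∀ n, 0 ≤ c n) :
    0 ≤ coeffIter A N n c := by
  induction n generalizing c with
  | zero => exact Finset.sum_nonneg fun n _ => div_nonneg (hc n) (by positivity)
  | succ n ih => exact ih (coeffStep_nonneg A N (n + 1) hc)

lemma integral_chain_geom (A : Finset ℕ) (N n : ℕ) {w : ℕ} (hw : w = n + 1) :
    ∫ t in chain A w,
        ∏ i : Fin w,
          (if (i : ℕ) + 1 = w then (1 - (t i) ^ N) / (1 - t i)
          else if (i : ℕ) + 1 ∈ A then 1 / (1 - t i)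
          else 1 / t i) = coeffIter A N n (fun _ => 1) := by
  subst hw
  have hc : ∀ n : ℕ, (0 : ℝ) ≤ (fun _ => 1 : ℕ → ℝ) n := fun _ => zero_le_one
  have hd : ∀ j {s : ℝ}, s ∈ Set.Ioo (0 : ℝ) 1 → 0 ≤ density A j s := fun j s hs => by
    have h0 := hs.1.le
    have h1 : 0 ≤ 1 - s := sub_nonneg.2 hs.2.le
    unfold density
    split_ifs <;> positivity
  have hF : Set.EqOn (fun t : Fin (n + 1) → ℝ => ∏ i : Fin (n + 1),
          (if (i : ℕ) + 1 = n + 1 then (1 - (t i) ^ N) / (1 - t i)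
          else if (i : ℕ) + 1 ∈ A then 1 / (1 - t i)
          else 1 / t i))
      (fun t => (∏ i : Fin n, density A (i + 1) (t i.castSucc)) *
        polyFun N (fun _ => 1) (t (Fin.last n))) (chain A (n + 1)) := fun t ht => by
    have hl := (ht.1 (Fin.last n)).2
    simp only [Fin.prod_univ_castSucc, Fin.val_castSucc, Fin.val_last, if_true, density, polyFun,
      one_mul, geom_sum_eq hl.ne]
    congr 1
    · refine Finset.prod_congr rfl fun i _ => ?_
      rw [if_neg (by omega)]
    · rw [← neg_div_neg_eq, neg_sub, neg_sub]
  rw [setIntegral_congr_fun (measurableSet_chain A _) hF, integral_eq_lintegral_of_nonneg_ae,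
    ← ENNReal.toReal_ofReal (coeffIter_nonneg A N n hc), ← lintegral_chain_polyFun A N n hc]
  · congr 1
    refine setLIntegral_congr_fun (measurableSet_chain A _) fun t ht => ?_
    rw [ENNReal.ofReal_mul (Finset.prod_nonneg fun i _ => hd _ (ht.1 _)),
      ENNReal.ofReal_prod_of_nonneg fun i _ => hd _ (ht.1 _)]
  · exact ae_restrict_of_forall_mem (measurableSet_chain A _) fun t ht =>
      mul_nonneg (Finset.prod_nonneg fun i _ => hd _ (ht.1 _)) (polyFun_nonneg hc (ht.1 _).1.le)
  · refine (Measurable.mul (Finset.measurable_prod _ fun i _ => ?_)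
      ((continuous_polyFun N _).measurable.comp (measurable_pi_apply _))).aestronglyMeasurable
    exact (measurable_density A _).comp (measurable_pi_apply _)

lemma coeffIter_congr {A B : Finset ℕ} (N : ℕ) {n : ℕ} (h : ∀ j, 1 ≤ j → j ≤ n → (j ∈ A ↔ j ∈ B))
    (c : ℕ → ℝ) : coeffIter A N n c = coeffIter B N n c := by
  induction n generalizing c with
  | zero => rfl
  | succ n ih =>
    have hs : coeffStep A N (n + 1) c = coeffStep B N (n + 1) c := by
      funext m
      simp only [coeffStep, h (n + 1) (by omega) le_rfl]
    rw [coeffIter, coeffIter, hs, ih fun j h1 h2 => h j h1 (by omega)]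

lemma coeffIter_add {A : Finset ℕ} (N : ℕ) {p b : ℕ} (h : ∀ j, p < j → j ≤ p + b → j ∉ A)
    (c : ℕ → ℝ) :
    coeffIter A N (p + b) c = coeffIter A N p (fun n => c n / ((n : ℝ) + 1) ^ b) := by
  induction b generalizing c with
  | zero => simp
  | succ b ih =>
    have hs : coeffStep A N (p + b + 1) c = fun n => c n / ((n : ℝ) + 1) := by
      funext m
      rw [coeffStep, if_neg (h _ (by omega) (by omega))]
    rw [← add_assoc, coeffIter, hs, ih fun j h1 h2 => h j h1 (by omega)]
    congr 1
    funext n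
    rw [div_div, pow_succ']

lemma sStar_eq_sum {k : List ℕ} {r : ℕ} (hr : k.length = r + 1) {n M : ℕ} (hn : n ≤ M) :
    sStar k n = ∑ m : Fin (r + 1) → Fin (M + 1),
      if (∀ i, 0 < (m i : ℕ)) ∧ (∀ i j, i ≤ j → (m i : ℕ) ≤ (m j : ℕ)) ∧ (m (Fin.last r) : ℕ) = n
      then ∏ i, 1 / ((m i : ℕ) : ℝ) ^ k.getD i 0 else 0 := by
  have h : ∀ {s : ℕ} (hs : k.length = s), sStar k n = ∑ m : Fin s → Fin (n + 1),
      if (∀ i, 0 < (m i : ℕ)) ∧ (∀ i j, i ≤ j → (m i : ℕ) ≤ (m j : ℕ)) ∧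
        (∀ i : Fin s, (i : ℕ) + 1 = s → (m i : ℕ) = n)
      then ∏ i, 1 / ((m i : ℕ) : ℝ) ^ k.getD i 0 else 0 := by
    rintro s rfl
    simp [sStar]
  have hlast : ∀ q : Fin (r + 1) → ℕ,
      (∀ i : Fin (r + 1), (i : ℕ) + 1 = r + 1 → q i = n) ↔ q (Fin.last r) = n := fun q =>
    ⟨fun h => h _ rfl, fun h i hi => by
      obtain rfl : i = Fin.last r := Fin.ext (by simpa using hi)
      exact h⟩
  rw [h hr]
  simp only [hlast]
  refine Fintype.sum_of_injective (fun m i => Fin.castLE (by omega) (m i)) ?_ _ _ ?_ ?_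
  · intro m m' hm
    funext i
    exact Fin.castLE_injective _ (congrFun hm i)
  · intro m hm
    rw [if_neg]
    rintro ⟨-, h2, h3⟩
    refine hm ⟨fun i => ⟨m i, ?_⟩, rfl⟩
    have := h2 i _ (Fin.le_last i)
    omega
  · intro m
    rfl

lemma sStar_singleton (a n : ℕ) : sStar [a] (n + 1) = 1 / ((n : ℝ) + 1) ^ a := by
  rw [sStar_eq_sum (r := 0) rfl le_rfl,
    Fintype.sum_eq_single (fun _ => Fin.last (n + 1))]
  · simp
  · intro m hm
    rw [if_neg]
    rintro ⟨-, -, h⟩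
    refine hm (funext fun i => ?_)
    obtain rfl : i = Fin.last 0 := Fin.ext (by omega)
    exact Fin.ext h

lemma sStar_append_singleton {k : List ℕ} (hk : k ≠ []) (a n : ℕ) :
    sStar (k ++ [a]) (n + 1) =
      (∑ m ∈ Finset.range (n + 1), sStar k (m + 1)) / ((n : ℝ) + 1) ^ a := by
  obtain ⟨r, hr⟩ : ∃ r, k.length = r + 1 :=
    Nat.exists_eq_succ_of_ne_zero (by simpa using hk)
  rw [Finset.sum_congr rfl fun m hm => sStar_eq_sum (M := n + 1) hr
      (by have := Finset.mem_range.1 hm; omega),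
    sStar_eq_sum (r := r + 1) (by simp [hr]) le_rfl, Finset.sum_comm,
    ← (Fin.snocEquiv fun _ => Fin (n + 1 + 1)).sum_comp, Fintype.sum_prod_type,
    Fintype.sum_eq_single (Fin.last (n + 1)), Finset.sum_div]
  · refine Finset.sum_congr rfl fun m _ => ?_
    have hprod : ∏ i, 1 / (((Fin.snoc m (Fin.last (n + 1)) : Fin (r + 2) → Fin (n + 2)) i : ℕ) : ℝ)
        ^ (k ++ [a]).getD i 0 =
        (∏ i, 1 / ((m i : ℕ) : ℝ) ^ k.getD i 0) / ((n : ℝ) + 1) ^ a := by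
      rw [Fin.prod_univ_castSucc, div_eq_mul_one_div]
      congr 1
      · refine Finset.prod_congr rfl fun i _ => ?_
        rw [Fin.snoc_castSucc, Fin.val_castSucc, List.getD_append _ _ _ _ (by omega)]
      · rw [Fin.snoc_last, List.getD_append_right _ _ _ _ (by simp [hr])]
        simp [hr]
    by_cases hm : (∀ i, 0 < (m i : ℕ)) ∧ ∀ i j, i ≤ j → (m i : ℕ) ≤ (m j : ℕ)
    · rw [if_pos, Finset.sum_eq_single ((m (Fin.last r) : ℕ) - 1), if_pos]
      · exact hprod
      · exact ⟨hm.1, hm.2, by have := hm.1 (Fin.last r); omega⟩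
      · intro b _ hb
        rw [if_neg]
        rintro ⟨-, -, h⟩
        omega
      · intro h
        exact absurd (Finset.mem_range.2 (by have := hm.1 (Fin.last r); omega)) h
      · simp only [Fin.snocEquiv, Equiv.coe_fn_mk]
        refine ⟨fun i => ?_, fun i j => ?_, by simp⟩
        · cases i using Fin.lastCases <;> simp [hm.1]
        · cases j using Fin.lastCases with
          | last =>
            intro _
            rw [Fin.snoc_last, Fin.val_last]
            exact Fin.is_le _
          | cast j =>
            cases i using Fin.lastCases with
            | last => exact fun h => absurd h (Fin.castSucc_lt_last j).not_ge
            | cast i => simpa using hm.2 i j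
    · rw [if_neg, Finset.sum_eq_zero, zero_div]
      · intro b _
        rw [if_neg]
        exact fun h => hm ⟨h.1, h.2.1⟩
      · rintro ⟨h1, h2, -⟩
        refine hm ⟨fun i => ?_, fun i j hij => ?_⟩
        · simpa [Fin.snocEquiv] using h1 i.castSucc
        · simpa [Fin.snocEquiv] using h2 i.castSucc j.castSucc (by simpa using hij)
  · intro x hx
    refine Finset.sum_eq_zero fun m _ => ?_
    rw [if_neg]
    rintro ⟨-, -, h⟩
    simp only [Fin.snocEquiv, Equiv.coe_fn_mk, Fin.snoc_last] at h
    exact hx (Fin.ext h)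

lemma sum_take_lt_sum {k : List ℕ} (hpos : ∀ x ∈ k, 0 < x) {i : ℕ} (hi : i < k.length) :
    (k.take i).sum < k.sum := by
  have h := List.sum_take_add_sum_drop k i
  have hd : 0 < (k.drop i).sum := by
    rw [List.drop_eq_getElem_cons hi, List.sum_cons]
    exact Nat.add_pos_left (hpos _ (List.getElem_mem hi)) _
  omega

lemma lt_sum_of_mem_Aset {k : List ℕ} (hpos : ∀ x ∈ k, 0 < x) {j : ℕ} (hj : j ∈ Aset k) :
    j < k.sum := by
  obtain ⟨i, hi, rfl⟩ := Finset.mem_image.1 hj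
  exact sum_take_lt_sum hpos (Finset.mem_Ico.1 hi).2

lemma mem_Aset_append_singleton {k : List ℕ} (hk : k ≠ []) (a j : ℕ) :
    j ∈ Aset (k ++ [a]) ↔ j ∈ Aset k ∨ j = k.sum := by
  have hl := List.length_pos_iff.2 hk
  simp only [Aset, Finset.mem_image, Finset.mem_Ico, List.length_append, List.length_singleton]
  constructor
  · rintro ⟨i, hi, rfl⟩
    rw [List.take_append_of_le_length (by omega)]
    by_cases h : i < k.length
    · exact Or.inl ⟨i, ⟨hi.1, h⟩, rfl⟩
    · exact Or.inr (by rw [List.take_of_length_le (by omega)])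
  · rintro (⟨i, hi, rfl⟩ | rfl)
    · exact ⟨i, by omega, by rw [List.take_append_of_le_length (by omega)]⟩
    · exact ⟨k.length, by omega, by simp⟩

lemma coeffIter_Aset (N : ℕ) {k : List ℕ} (hk : k ≠ []) (hpos : ∀ x ∈ k, 0 < x) {w : ℕ}
    (hw : k.sum = w + 1) (c : ℕ → ℝ) :
    coeffIter (Aset k) N w c = ∑ n ∈ Finset.range N, c n * sStar k (n + 1) := by
  induction k using List.reverseRecOn generalizing w c with
  | nil => exact absurd rfl hk
  | append_singleton k a ih =>
    simp only [List.sum_append, List.sum_singleton] at hw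
    have ha : 0 < a := hpos a (by simp)
    by_cases hk' : k = []
    · subst hk'
      simp only [List.nil_append, List.sum_nil, zero_add] at hw ⊢
      have h := coeffIter_add (A := Aset [a]) N (p := 0) (b := w) (by simp [Aset]) c
      rw [zero_add] at h
      rw [h, coeffIter]
      refine Finset.sum_congr rfl fun n _ => ?_
      rw [sStar_singleton, hw, pow_succ, div_div, mul_one_div]
    · have hpos' : ∀ x ∈ k, 0 < x := fun x hx => hpos x (by simp [hx])
      obtain ⟨v, hv⟩ : ∃ v, k.sum = v + 1 := Nat.exists_eq_succ_of_ne_zero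
        (List.sum_pos _ hpos' hk').ne'
      obtain ⟨b, rfl⟩ : ∃ b, a = b + 1 := Nat.exists_eq_succ_of_ne_zero ha.ne'
      obtain rfl : w = (v + 1) + b := by omega
      rw [coeffIter_add N fun j h1 _ hj => ?_, coeffIter,
        coeffIter_congr (B := Aset k) N fun j _ h2 => ?_, ih hk' hpos' hv]
      · have hmem : v + 1 ∈ Aset (k ++ [b + 1]) :=
          (mem_Aset_append_singleton hk' _ _).2 (Or.inr hv.symm)
        simp only [coeffStep, if_pos hmem, sStar_append_singleton hk', Finset.sum_mul,
          Finset.sum_div, Finset.mul_sum]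
        rw [Finset.sum_comm' (t' := Finset.range N) (s' := fun n => Finset.range (n + 1))
          (by intro x y; simp only [Finset.mem_range, Finset.mem_Ico]; omega)]
        refine Finset.sum_congr rfl fun n _ => Finset.sum_congr rfl fun m _ => ?_
        rw [pow_succ, div_div]
        ring
      · rw [mem_Aset_append_singleton hk']
        exact or_iff_left (by omega)
      · rcases (mem_Aset_append_singleton hk' _ _).1 hj with h | h
        · have := lt_sum_of_mem_Aset hpos' h
          omega
        · omega

/-- Integral representation of `S⋆(k, N)`:
`S⋆(k,N) = ∫_{Δ(k)} ω_{δ(1)}(t₁) ⋯ ω_{δ(k-1)}(t_{k-1}) · (1 - t_k^N)/(1 - t_k) dt_k`. -/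
theorem SStar_eq_integral (k : List ℕ) (hk : k ≠ []) (hpos : ∀ x ∈ k, 0 < x)
    (N : ℕ) (hN : 1 ≤ N) :
    SStar k N =
      ∫ t in Delta k,
        ∏ i : Fin k.sum,
          if (i : ℕ) + 1 = k.sum then (1 - (t i) ^ N) / (1 - t i)
          else if (i : ℕ) + 1 ∈ Aset k then 1 / (1 - t i)
          else 1 / t i := by
  obtain ⟨w, hw⟩ : ∃ w, k.sum = w + 1 :=
    Nat.exists_eq_succ_of_ne_zero (List.sum_pos _ hpos hk).ne'
  refine Eq.trans ?_ (integral_chain_geom (Aset k) N w hw).symm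
  rw [coeffIter_Aset N hk hpos hw, SStar, Finset.range_eq_Ico]
  simp only [one_mul]
  rw [Finset.sum_Ico_add' (sStar k) 0 N 1, zero_add]
  rfl

end Kawashima
end

section
/- Let k be a nonempty index and let ρ be the last component of the Hoffman dual k∨ of k. Then the Newton series F_k(z)=Σ_{n=1}^∞ (−1)^{n−1} s⋆(k∨,n)·binom(z,n) converges uniformly on compact subsets of the half plane {z∈ℂ : Re(z)>−ρ}, and diverges at every z with Re(z)<−ρ. -/
open MeasureTheory Filter Topology

namespace Kawashima

lemma zipWith_sub_pos (L : List ℕ) (c : ℕ) (h : (c :: L).Pairwise (· < ·)) :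
    ∀ x ∈ L.zipWith (fun a b => a - b) (c :: L), 0 < x := by
  induction L generalizing c with
  | nil => simp
  | cons a L ih =>
    intro x hx
    rw [List.zipWith_cons_cons, List.mem_cons] at hx
    rcases hx with rfl | hx
    · have := List.rel_of_pairwise_cons h (List.mem_cons_self (a := a) (l := L))
      omega
    · exact ih a h.of_cons x hx

lemma hdual_pos (k : List ℕ) (hk : k ≠ []) (hpos : ∀ x ∈ k, 0 < x) :
    ∀ x ∈ hdual k, 0 < x := by
  have hw : 0 < k.sum := by
    obtain ⟨a, k', rfl⟩ := List.exists_cons_of_ne_nil hk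
    have := hpos a (by simp)
    simp only [List.sum_cons]
    omega
  apply zipWith_sub_pos
  rw [List.pairwise_cons]
  refine ⟨fun a ha => ?_, (Finset.sortedLT_sort _).pairwise⟩
  rw [Finset.mem_sort, Finset.mem_insert, Finset.mem_sdiff, Finset.mem_Icc] at ha
  omega

lemma cbinom_succ (z : ℂ) (n : ℕ) :
    cbinom z (n + 1) = cbinom z n * ((z - n) / ((n : ℂ) + 1)) := by
  have h : ((n.factorial : ℕ) : ℂ) ≠ 0 := Nat.cast_ne_zero.mpr n.factorial_ne_zero
  have h' : (n : ℂ) + 1 ≠ 0 := by exact_mod_cast n.succ_ne_zero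
  simp only [cbinom, descPochhammer_succ_eval, Nat.factorial_succ]
  push_cast
  field_simp

lemma cbinom_zero (z : ℂ) : cbinom z 0 = 1 := by simp [cbinom]

lemma norm_one_sub_div_le (z : ℂ) (m : ℝ) (hm : 1 ≤ m) :
    ‖z - m‖ / m ≤ Real.exp (-z.re / m + ‖z‖ ^ 2 * (1 / m - 1 / (m + 1))) := by
  have hm0 : 0 < m := by linarith
  refine le_of_sq_le_sq ?_ (Real.exp_pos _).le
  have h1 : (‖z - m‖ / m) ^ 2 = 1 + (-2 * z.re / m + ‖z‖ ^ 2 / m ^ 2) := by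
    rw [div_pow, Complex.sq_norm, Complex.sq_norm, Complex.normSq_apply, Complex.normSq_apply]
    simp only [Complex.sub_re, Complex.sub_im, Complex.ofReal_re, Complex.ofReal_im]
    field_simp
    ring
  have h2 : ‖z‖ ^ 2 / m ^ 2 ≤ 2 * (‖z‖ ^ 2 * (1 / m - 1 / (m + 1))) := by
    have h3 : 1 / m ^ 2 ≤ 2 * (1 / m - 1 / (m + 1)) := by
      have h4 : 2 * (1 / m - 1 / (m + 1)) = 2 / (m * (m + 1)) := by field_simp; ring
      rw [h4, div_le_div_iff₀ (by positivity) (by positivity)]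
      nlinarith
    have := mul_le_mul_of_nonneg_left h3 (sq_nonneg ‖z‖)
    calc ‖z‖ ^ 2 / m ^ 2 = ‖z‖ ^ 2 * (1 / m ^ 2) := by ring
      _ ≤ _ := this
      _ = _ := by ring
  rw [h1, ← Real.exp_nat_mul]
  have h5 := Real.add_one_le_exp (-2 * z.re / m + ‖z‖ ^ 2 / m ^ 2)
  have h6 : -2 * z.re / m + ‖z‖ ^ 2 / m ^ 2 ≤
      ((2 : ℕ) : ℝ) * (-z.re / m + ‖z‖ ^ 2 * (1 / m - 1 / (m + 1))) := by
    have : -2 * z.re / m = 2 * (-z.re / m) := by ring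
    push_cast
    linarith
  have := Real.exp_le_exp.mpr h6
  linarith

lemma norm_cbinom_succ_le_exp_harmonic (z : ℂ) (n : ℕ) :
    ‖cbinom z (n + 1)‖ ≤ ‖z‖ / (n + 1) *
      Real.exp (-z.re * (harmonic n : ℝ) + ‖z‖ ^ 2 * (1 - 1 / ((n : ℝ) + 1))) := by
  induction n with
  | zero => simp [cbinom_succ, cbinom_zero]
  | succ n ih =>
    have h := norm_one_sub_div_le z ((n : ℝ) + 1) (by linarith [n.cast_nonneg (α := ℝ)])
    rw [cbinom_succ, norm_mul, norm_div, harmonic_succ]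
    have e1 : ‖((n + 1 : ℕ) : ℂ) + 1‖ = (n : ℝ) + 1 + 1 := by
      have : ((n + 1 : ℕ) : ℂ) + 1 = ((n + 1 + 1 : ℕ) : ℂ) := by push_cast; ring
      rw [this, Complex.norm_natCast]; push_cast; ring
    have e2 : ‖z - ((n + 1 : ℕ) : ℂ)‖ = ‖z - (((n : ℝ) + 1 : ℝ) : ℂ)‖ := by push_cast; rfl
    rw [e1, e2]
    have hn : (0 : ℝ) < n + 1 := by positivity
    calc ‖cbinom z (n + 1)‖ * (‖z - (((n : ℝ) + 1 : ℝ) : ℂ)‖ / ((n : ℝ) + 1 + 1))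
        = ((n : ℝ) + 1) / ((n : ℝ) + 1 + 1) * (‖cbinom z (n + 1)‖ *
            (‖z - (((n : ℝ) + 1 : ℝ) : ℂ)‖ / ((n : ℝ) + 1))) := by field_simp
      _ ≤ ((n : ℝ) + 1) / ((n : ℝ) + 1 + 1) * ((‖z‖ / (n + 1) *
            Real.exp (-z.re * (harmonic n : ℝ) + ‖z‖ ^ 2 * (1 - 1 / ((n : ℝ) + 1)))) *
            Real.exp (-z.re / ((n : ℝ) + 1) +
              ‖z‖ ^ 2 * (1 / ((n : ℝ) + 1) - 1 / ((n : ℝ) + 1 + 1)))) := by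
          gcongr
      _ = _ := by
          rw [mul_assoc (‖z‖ / ((n : ℝ) + 1)), ← Real.exp_add]
          push_cast
          have : -z.re * (harmonic n : ℝ) + ‖z‖ ^ 2 * (1 - 1 / ((n : ℝ) + 1)) +
              (-z.re / ((n : ℝ) + 1) +
              ‖z‖ ^ 2 * (1 / ((n : ℝ) + 1) - 1 / ((n : ℝ) + 1 + 1))) =
              -z.re * ((harmonic n : ℝ) + ((n : ℝ) + 1)⁻¹) +
              ‖z‖ ^ 2 * (1 - 1 / ((n : ℝ) + 1 + 1)) := by
            rw [div_eq_mul_inv (-z.re)]; ring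
          rw [this]
          field_simp

lemma norm_cbinom_succ_le (z : ℂ) (n : ℕ) :
    ‖cbinom z (n + 1)‖ ≤
      ‖z‖ * Real.exp (|z.re| + ‖z‖ ^ 2) * ((n : ℝ) + 1) ^ (-z.re - 1) := by
  have hn : (0 : ℝ) < n + 1 := by positivity
  refine (norm_cbinom_succ_le_exp_harmonic z n).trans ?_
  have h1 : |(harmonic n : ℝ) - Real.log (n + 1)| ≤ 1 := by
    have h2 := log_add_one_le_harmonic n
    have h3 := harmonic_le_one_add_log n
    have h4 : Real.log n ≤ Real.log (n + 1) := by
      rcases n.eq_zero_or_pos with rfl | h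
      · simp
      · exact Real.log_le_log (by exact_mod_cast h) (by linarith)
    push_cast at h2
    rw [abs_le]
    constructor <;> linarith
  have h5 : -z.re * (harmonic n : ℝ) ≤ |z.re| + Real.log (n + 1) * -z.re := by
    have : -z.re * ((harmonic n : ℝ) - Real.log (n + 1)) ≤ |z.re| * 1 := by
      refine (le_abs_self _).trans ?_
      rw [abs_mul, abs_neg]
      gcongr
    linarith
  have h6 : ‖z‖ ^ 2 * (1 - 1 / ((n : ℝ) + 1)) ≤ ‖z‖ ^ 2 := by
    refine mul_le_of_le_one_right (sq_nonneg _) ?_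
    have : 0 ≤ 1 / ((n : ℝ) + 1) := by positivity
    linarith
  calc _ ≤ ‖z‖ / (n + 1) * Real.exp (|z.re| + ‖z‖ ^ 2 + Real.log (n + 1) * -z.re) := by
        refine mul_le_mul_of_nonneg_left (Real.exp_le_exp.mpr ?_) (by positivity)
        linarith
    _ = _ := by
        rw [Real.exp_add, Real.rpow_sub_one hn.ne', Real.rpow_def_of_pos hn]
        ring

lemma sStar_nonneg (l : List ℕ) (N : ℕ) : 0 ≤ sStar l N := by
  refine Finset.sum_nonneg fun m _ => ?_
  split_ifs
  · positivity
  · exact le_rfl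

lemma inv_pow_le_sStar (l : List ℕ) (ρ N : ℕ) (hρ : l.getLast? = some ρ) (hN : 0 < N) :
    1 / (N : ℝ) ^ ρ ≤ sStar l N := by
  obtain ⟨l', rfl⟩ : ∃ l', l = l' ++ [ρ] := List.getLast?_eq_some_iff.mp hρ
  let m : Fin (l' ++ [ρ]).length → Fin (N + 1) := fun i =>
    if (i : ℕ) + 1 = (l' ++ [ρ]).length then ⟨N, by omega⟩ else ⟨1, by omega⟩
  have hm : ∀ i, (m i : ℕ) = if (i : ℕ) + 1 = (l' ++ [ρ]).length then N else 1 := by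
    intro i
    simp only [m]
    split_ifs <;> rfl
  have hcond : (∀ i, 0 < (m i : ℕ)) ∧
       (∀ i j : Fin (l' ++ [ρ]).length, i ≤ j → (m i : ℕ) ≤ (m j : ℕ)) ∧
       (∀ i : Fin (l' ++ [ρ]).length, (i : ℕ) + 1 = (l' ++ [ρ]).length → (m i : ℕ) = N) := by
    refine ⟨fun i => ?_, fun i j hij => ?_, fun i hi => ?_⟩
    · rw [hm]; split_ifs <;> omega
    · have := i.2
      have := j.2
      have : (i : ℕ) ≤ j := hij
      rw [hm, hm]; split_ifs <;> omega
    · rw [hm, if_pos hi]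
  have hle := Finset.single_le_sum (s := Finset.univ) (a := m)
    (f := fun m : Fin (l' ++ [ρ]).length → Fin (N + 1) =>
    if (∀ i, 0 < (m i : ℕ)) ∧
       (∀ i j : Fin (l' ++ [ρ]).length, i ≤ j → (m i : ℕ) ≤ (m j : ℕ)) ∧
       (∀ i : Fin (l' ++ [ρ]).length, (i : ℕ) + 1 = (l' ++ [ρ]).length → (m i : ℕ) = N)
    then ∏ i : Fin (l' ++ [ρ]).length, 1 / ((m i : ℕ) : ℝ) ^ (l' ++ [ρ]).get i
    else 0) (fun m _ => by
      split_ifs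
      · positivity
      · exact le_rfl) (Finset.mem_univ m)
  refine le_trans (le_of_eq ?_) hle
  rw [if_pos hcond, Finset.prod_eq_single ⟨l'.length, by simp⟩]
  · rw [hm, if_pos (by simp)]
    simp
  · intro i _ hi
    rw [hm, if_neg]
    · simp
    · intro h
      apply hi
      ext
      simpa using h
  · simp

lemma sStar_le (l : List ℕ) (ρ N : ℕ) (hρ : l.getLast? = some ρ) (hl : ∀ x ∈ l, 0 < x) :
    sStar l N ≤ (1 + Real.log N) ^ (l.length - 1) * (1 / (N : ℝ) ^ ρ) := by
  obtain ⟨l', rfl⟩ : ∃ l', l = l' ++ [ρ] := List.getLast?_eq_some_iff.mp hρ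
  set l := l' ++ [ρ] with hl_def
  let f : Fin l.length → Fin (N + 1) → ℝ := fun i m =>
    if 0 < (m : ℕ) ∧ ((i : ℕ) + 1 = l.length → (m : ℕ) = N) then 1 / (m : ℝ) ^ l.get i else 0
  have hf0 : ∀ i m, 0 ≤ f i m := by
    intro i m
    simp only [f]
    split_ifs
    · positivity
    · exact le_rfl
  have h1 : sStar l N ≤ ∏ i, ∑ m, f i m := by
    rw [Finset.prod_univ_sum, Fintype.piFinset_univ]
    refine Finset.sum_le_sum fun m _ => ?_
    split_ifs with h
    · refine le_of_eq (Finset.prod_congr rfl fun i _ => ?_)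
      simp only [f]
      rw [if_pos ⟨h.1 i, h.2.2 i⟩]
    · exact Finset.prod_nonneg fun i _ => hf0 i _
  refine h1.trans ?_
  have hlen : l.length = l'.length + 1 := by simp [l]
  have hsum : ∀ i, ∑ m, f i m ≤ 1 + Real.log N := by
    intro i
    refine le_trans ?_ (harmonic_le_one_add_log N)
    rw [Fin.sum_univ_succ]
    have : f i 0 = 0 := by simp [f]
    rw [this, zero_add, harmonic, Rat.cast_sum, ← Fin.sum_univ_eq_sum_range
      (fun i => (((↑(i + 1))⁻¹ : ℚ) : ℝ))]
    refine Finset.sum_le_sum fun m _ => ?_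
    simp only [f]
    have hi := hl (l.get i) (List.get_mem _ _)
    split_ifs
    · push_cast
      rw [Fin.val_succ, one_div]
      push_cast
      refine inv_anti₀ (by positivity) (le_self_pow₀ ?_ hi.ne')
      linarith [(m : ℕ).cast_nonneg (α := ℝ)]
    · positivity
  have hlast : ∑ m, f ⟨l'.length, by omega⟩ m ≤ 1 / (N : ℝ) ^ ρ := by
    rw [Finset.sum_eq_single (Fin.last N)]
    · simp only [f]
      split_ifs
      · simp [l]
      · positivity
    · intro m _ hm
      simp only [f]
      rw [if_neg]
      rintro ⟨-, h⟩
      exact hm (Fin.ext (h hlen.symm))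
    · simp
  rw [← Finset.prod_erase_mul _ _ (Finset.mem_univ (⟨l'.length, by omega⟩ : Fin l.length))]
  refine mul_le_mul ?_ hlast (Finset.sum_nonneg fun m _ => hf0 _ _) ?_
  · refine (Finset.prod_le_prod (fun i _ => Finset.sum_nonneg fun m _ => hf0 i m)
      fun i _ => hsum i).trans (le_of_eq ?_)
    simp
  · have := Real.log_natCast_nonneg N
    positivity

lemma one_add_log_pow_le (ε : ℝ) (hε : 0 < ε) (r : ℕ) (x : ℝ) (hx : 1 ≤ x) :
    (1 + Real.log x) ^ r ≤ (1 + (r + 1) / ε) ^ r * x ^ ε := by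
  have hr : (0 : ℝ) < r + 1 := by positivity
  have hlog := Real.log_nonneg hx
  have h1 := Real.log_le_rpow_div (x := x) (by linarith) (div_pos hε hr)
  have h2 : 1 ≤ x ^ (ε / (r + 1)) := Real.one_le_rpow hx (by positivity)
  have h3 : 1 + Real.log x ≤ (1 + (r + 1) / ε) * x ^ (ε / (r + 1)) := by
    calc _ ≤ x ^ (ε / (r + 1)) + x ^ (ε / (r + 1)) / (ε / (r + 1)) := add_le_add h2 h1
      _ = _ := by field_simp
  calc (1 + Real.log x) ^ r ≤ ((1 + (r + 1) / ε) * x ^ (ε / (r + 1))) ^ r := by gcongr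
    _ = (1 + (r + 1) / ε) ^ r * x ^ (ε / (r + 1) * r) := by
      rw [mul_pow, Real.rpow_mul_natCast (by linarith)]
    _ ≤ _ := by
      gcongr
      rw [div_mul_eq_mul_div, div_le_iff₀ hr]
      nlinarith

lemma norm_newton_term_le (l : List ℕ) (ρ : ℕ) (hρ : l.getLast? = some ρ)
    (hl : ∀ x ∈ l, 0 < x) (δ R : ℝ) (hδ : 0 < δ) (z : ℂ) (hz : ‖z‖ ≤ R)
    (hre : -(ρ : ℝ) + δ ≤ z.re) (n : ℕ) :
    ‖(-1 : ℂ) ^ n * ((sStar l (n + 1) : ℝ) : ℂ) * cbinom z (n + 1)‖ ≤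
      (1 + ((l.length - 1 : ℕ) + 1) / (δ / 2)) ^ (l.length - 1) *
        (R * Real.exp (R + R ^ 2)) * ((n : ℝ) + 1) ^ (-1 - δ / 2) := by
  have hn : (1 : ℝ) ≤ n + 1 := by linarith [n.cast_nonneg (α := ℝ)]
  have hn0 : (0 : ℝ) < n + 1 := by linarith
  have hR : 0 ≤ R := (norm_nonneg z).trans hz
  have h1 := sStar_le l ρ (n + 1) hρ hl
  have h2 := one_add_log_pow_le (δ / 2) (by positivity) (l.length - 1) _ hn
  push_cast at h1
  have h3 := norm_cbinom_succ_le z n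
  rw [norm_mul, norm_mul, norm_pow, norm_neg, norm_one, one_pow, one_mul, Complex.norm_real,
    Real.norm_of_nonneg (sStar_nonneg _ _)]
  set A : ℝ := (1 + ((l.length - 1 : ℕ) + 1) / (δ / 2)) ^ (l.length - 1) with hA
  have hA0 : 0 ≤ A := by positivity
  calc sStar l (n + 1) * ‖cbinom z (n + 1)‖
      ≤ (A * ((n : ℝ) + 1) ^ (δ / 2) * (1 / ((n : ℝ) + 1) ^ ρ)) *
        (R * Real.exp (R + R ^ 2) * ((n : ℝ) + 1) ^ ((ρ : ℝ) - δ - 1)) := by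
        refine mul_le_mul (h1.trans ?_) (h3.trans ?_) (norm_nonneg _) (by positivity)
        · gcongr
        · gcongr
          · exact (Complex.abs_re_le_norm z).trans hz
          · linarith
    _ = A * (R * Real.exp (R + R ^ 2)) * (((n : ℝ) + 1) ^ (δ / 2) *
          ((n : ℝ) + 1) ^ (-(ρ : ℝ)) * ((n : ℝ) + 1) ^ ((ρ : ℝ) - δ - 1)) := by
        rw [Real.rpow_neg hn0.le, Real.rpow_natCast]
        ring
    _ = _ := by
        rw [← Real.rpow_add hn0, ← Real.rpow_add hn0]
        congr 2
        ring

lemma sum_Icc_newton_eq_sum_range (l : List ℕ) (z : ℂ) (N : ℕ) :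
    ∑ n ∈ Finset.Icc 1 N, (-1 : ℂ) ^ (n - 1) * ((sStar l n : ℝ) : ℂ) * cbinom z n =
      ∑ n ∈ Finset.range N, (-1 : ℂ) ^ n * ((sStar l (n + 1) : ℝ) : ℂ) * cbinom z (n + 1) := by
  rw [← Finset.Ico_succ_right_eq_Icc, Finset.sum_Ico_eq_sum_range]
  simp [add_comm 1]

lemma norm_sum_mul_le_of_variation (t r : ℕ → ℂ) (p : ℕ → ℝ) (B C : ℝ)
    (hB : ∀ N, ‖∑ n ∈ Finset.range N, t n‖ ≤ B) (hC : 0 ≤ C) (hr : ∀ n, ‖r n‖ ≤ p n)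
    (hp : Antitone p) (hv : ∀ n, ‖r (n + 1) - r n‖ ≤ C * (p n - p (n + 1))) (N : ℕ) :
    ‖∑ n ∈ Finset.range N, r n * t n‖ ≤ (1 + C) * p 0 * B := by
  have hB0 : 0 ≤ B := (norm_nonneg _).trans (hB 0)
  have parts : ∑ n ∈ Finset.range N, r n * t n = r N * ∑ n ∈ Finset.range N, t n -
      ∑ n ∈ Finset.range N, (r (n + 1) - r n) * ∑ m ∈ Finset.range (n + 1), t m := by
    induction N with
    | zero => simp
    | succ N ih =>
      rw [Finset.sum_range_succ, ih, Finset.sum_range_succ _ N, Finset.sum_range_succ _ N,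
        Finset.sum_range_succ t N]
      ring
  have h1 : ‖r N * ∑ n ∈ Finset.range N, t n‖ ≤ p 0 * B := by
    rw [norm_mul]
    exact mul_le_mul ((hr N).trans (hp N.zero_le)) (hB N) (norm_nonneg _)
      ((norm_nonneg _).trans (hr 0))
  have h2 : ‖∑ n ∈ Finset.range N, (r (n + 1) - r n) * ∑ m ∈ Finset.range (n + 1), t m‖ ≤
      C * p 0 * B := by
    calc _ ≤ ∑ n ∈ Finset.range N, C * (p n - p (n + 1)) * B := by
          refine norm_sum_le_of_le _ fun n _ => ?_
          rw [norm_mul]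
          exact mul_le_mul (hv n) (hB _) (norm_nonneg _) ((norm_nonneg _).trans (hv n))
      _ = C * (p 0 - p N) * B := by
          rw [← Finset.sum_mul, ← Finset.mul_sum, Finset.sum_range_sub']
      _ ≤ _ := by
          gcongr
          linarith [(norm_nonneg _).trans (hr N)]
  rw [parts]
  calc _ ≤ _ := norm_sub_le _ _
    _ ≤ p 0 * B + C * p 0 * B := add_le_add h1 h2
    _ = _ := by ring

lemma neg_one_pow_mul_cbinom_neg (ρ n : ℕ) :
    (-1 : ℂ) ^ n * cbinom (-(ρ : ℂ)) n = (((ρ.ascFactorial n : ℝ) / n.factorial : ℝ) : ℂ) := by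
  induction n with
  | zero => simp [cbinom_zero]
  | succ n ih =>
    have h : ((n.factorial : ℕ) : ℂ) ≠ 0 := Nat.cast_ne_zero.mpr n.factorial_ne_zero
    have h' : (n : ℂ) + 1 ≠ 0 := by exact_mod_cast n.succ_ne_zero
    rw [cbinom_succ, pow_succ]
    rw [show (-1 : ℂ) ^ n * -1 * (cbinom (-(ρ : ℂ)) n * ((-(ρ : ℂ) - n) / ((n : ℂ) + 1))) =
      ((-1 : ℂ) ^ n * cbinom (-(ρ : ℂ)) n) * ((ρ + n) / ((n : ℂ) + 1)) by ring, ih,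
      Nat.ascFactorial_succ, Nat.factorial_succ]
    push_cast
    field_simp

lemma inv_factorial_mul_inv_le (ρ n : ℕ) (hρ : 0 < ρ) :
    1 / ((ρ - 1).factorial : ℝ) * (1 / ((n : ℝ) + 1)) ≤
      1 / ((n : ℝ) + 1) ^ ρ * ((ρ.ascFactorial (n + 1) : ℝ) / (n + 1).factorial) := by
  obtain ⟨q, rfl⟩ : ∃ q, ρ = q + 1 := ⟨ρ - 1, by omega⟩
  have h1 : q.factorial * (q + 1).ascFactorial (n + 1) = (q + (n + 1)).factorial :=
    Nat.factorial_mul_ascFactorial _ _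
  have h2 : (n + 1).factorial * (n + 1) ^ q ≤ (n + 1 + q).factorial :=
    (Nat.mul_le_mul_left _ (Nat.pow_le_pow_left (Nat.le_succ _) _)).trans
      Nat.factorial_mul_pow_le_factorial
  rw [show n + 1 + q = q + (n + 1) by ring, ← h1] at h2
  have h3 : ((n + 1).factorial : ℝ) * ((n : ℝ) + 1) ^ q ≤
      q.factorial * ((q + 1).ascFactorial (n + 1) : ℝ) := by exact_mod_cast h2
  have hq : (0 : ℝ) < q.factorial := by exact_mod_cast q.factorial_pos
  have hn : (0 : ℝ) < (n + 1).factorial := by exact_mod_cast (n + 1).factorial_pos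
  rw [Nat.add_sub_cancel, div_mul_div_comm, div_mul_div_comm,
    div_le_div_iff₀ (by positivity) (by positivity), pow_succ]
  have : (0 : ℝ) < n + 1 := by positivity
  nlinarith [mul_le_mul_of_nonneg_left h3 this.le]

lemma not_tendsto_newton (l : List ℕ) (ρ : ℕ) (hρ : l.getLast? = some ρ)
    (hl : ∀ x ∈ l, 0 < x) (z : ℂ) (hz : z.re < -(ρ : ℝ)) (L : ℂ) :
    ¬ Tendsto (fun N => ∑ n ∈ Finset.range N,
      (-1 : ℂ) ^ n * ((sStar l (n + 1) : ℝ) : ℂ) * cbinom z (n + 1)) atTop (𝓝 L) := by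
  intro hL
  have hρ0 : 0 < ρ := hl ρ (List.mem_of_getLast? hρ)
  obtain ⟨B, hB⟩ := hL.norm.bddAbove_range
  replace hB : ∀ N, ‖∑ n ∈ Finset.range N,
      (-1 : ℂ) ^ n * ((sStar l (n + 1) : ℝ) : ℂ) * cbinom z (n + 1)‖ ≤ B :=
    fun N => hB ⟨N, rfl⟩
  have hpos : ∀ j : ℕ, (0 : ℝ) < j - z.re := fun j => by
    have := j.cast_nonneg (α := ℝ)
    have := ρ.cast_nonneg (α := ℝ)
    linarith
  have hre : ∀ j : ℕ, (j : ℝ) - z.re ≤ ‖(j : ℂ) - z‖ := fun j => by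
    have := Complex.re_le_norm ((j : ℂ) - z)
    simpa using this
  have hne : ∀ j : ℕ, (j : ℂ) - z ≠ 0 := fun j => norm_pos_iff.mp ((hpos j).trans_le (hre j))
  let r : ℕ → ℂ := fun n => ∏ j ∈ Finset.range n, ((j : ℂ) + ρ) / (j - z)
  let p : ℕ → ℝ := fun n => ∏ j ∈ Finset.range n, ((j : ℝ) + ρ) / (j - z.re)
  have hp0 : ∀ n, 0 ≤ p n := fun n => Finset.prod_nonneg fun j _ => by
    have := hpos j
    positivity
  have hnorm : ∀ j : ℕ, ‖(j : ℂ) + ρ‖ = j + ρ := fun j => by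
    rw [← Nat.cast_add, Complex.norm_natCast, Nat.cast_add]
  have hrp : ∀ n, ‖r n‖ ≤ p n := fun n => by
    simp only [r, p]
    rw [norm_prod]
    refine Finset.prod_le_prod (fun _ _ => norm_nonneg _) fun j _ => ?_
    rw [norm_div, hnorm]
    have := hpos j
    gcongr
    exact hre j
  have hd : 0 < -(ρ : ℝ) - z.re := by linarith
  have hpdiff : ∀ n, p n - p (n + 1) = p n * ((-(ρ : ℝ) - z.re) / (n - z.re)) := fun n => by
    have := (hpos n).ne'
    simp only [p]
    rw [Finset.prod_range_succ]
    field_simp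
    ring
  have hpanti : Antitone p := antitone_nat_of_succ_le fun n => by
    have : 0 ≤ p n * ((-(ρ : ℝ) - z.re) / (n - z.re)) :=
      mul_nonneg (hp0 n) (div_pos hd (hpos n)).le
    linarith [hpdiff n]
  have hv : ∀ n, ‖r (n + 1) - r n‖ ≤
      ‖(ρ : ℂ) + z‖ / (-(ρ : ℝ) - z.re) * (p n - p (n + 1)) := fun n => by
    have e : r (n + 1) - r n = r n * (((ρ : ℂ) + z) / (n - z)) := by
      have := hne n
      simp only [r]
      rw [Finset.prod_range_succ]
      field_simp
      ring
    rw [e, hpdiff, norm_mul, norm_div]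
    calc _ ≤ p n * (‖(ρ : ℂ) + z‖ / (n - z.re)) := by
          have := hpos n
          gcongr
          · exact hp0 n
          · exact hrp n
          · exact hre n
      _ = _ := by field_simp
  have hrc : ∀ n, r n * ((-1 : ℂ) ^ n * cbinom z n) = (-1 : ℂ) ^ n * cbinom (-(ρ : ℂ)) n := by
    intro n
    induction n with
    | zero => simp [r, cbinom_zero]
    | succ n ih =>
      have h := hne n
      have hr : r (n + 1) = r n * (((n : ℂ) + ρ) / (n - z)) := Finset.prod_range_succ _ _
      rw [cbinom_succ, cbinom_succ, hr]
      calc _ = (r n * ((-1 : ℂ) ^ n * cbinom z n)) * (((n : ℂ) + ρ) / (n + 1)) *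
            (((n : ℂ) - z) / (n - z)) := by ring
        _ = _ := by rw [ih, div_self h]; ring
  have hbound := norm_sum_mul_le_of_variation _ (fun n => r (n + 1)) (fun n => p (n + 1)) B
    (‖(ρ : ℂ) + z‖ / (-(ρ : ℝ) - z.re)) hB (by positivity) (fun n => hrp _)
    (fun a b hab => hpanti (by omega)) (fun n => hv _)
  have hterm : ∀ n, r (n + 1) *
      ((-1 : ℂ) ^ n * ((sStar l (n + 1) : ℝ) : ℂ) * cbinom z (n + 1)) =
      -((sStar l (n + 1) * ((ρ.ascFactorial (n + 1) : ℝ) / (n + 1).factorial) : ℝ) : ℂ) := by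
    intro n
    rw [Complex.ofReal_mul, ← neg_one_pow_mul_cbinom_neg, ← hrc]
    ring
  have hharm := (Real.tendsto_sum_range_one_div_nat_succ_atTop.const_mul_atTop
    (show (0 : ℝ) < 1 / ((ρ - 1).factorial : ℝ) by positivity))
  obtain ⟨N, hN⟩ := (hharm.eventually_gt_atTop _).exists
  refine absurd (hbound N) (not_le.mpr (hN.trans_le ?_))
  simp only [hterm]
  rw [Finset.sum_neg_distrib, norm_neg, ← Complex.ofReal_sum, Complex.norm_real, Finset.mul_sum]
  refine le_trans (Finset.sum_le_sum fun n _ => ?_) (Real.le_norm_self _)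
  refine (inv_factorial_mul_inv_le ρ n hρ0).trans ?_
  have := inv_pow_le_sStar l ρ (n + 1) hρ n.succ_pos
  push_cast at this
  gcongr

/-- The Newton series `F_k(z) = Σ_{n=1}^∞ (-1)^{n-1} s⋆(k∨,n) binom(z,n)`
converges uniformly on compact subsets of the half plane `Re(z) > -ρ`, where `ρ` is the
last component of the Hoffman dual of `k`, and diverges at every `z` with `Re(z) < -ρ`. -/
theorem newton_series_convergence (k : List ℕ) (hk : k ≠ []) (hpos : ∀ x ∈ k, 0 < x)
    (ρ : ℕ) (hρ : (hdual k).getLast? = some ρ) :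
    (∀ K : Set ℂ, IsCompact K → K ⊆ {z : ℂ | -(ρ : ℝ) < z.re} →
      TendstoUniformlyOn
        (fun N z => ∑ n ∈ Finset.Icc 1 N,
          (-1 : ℂ) ^ (n - 1) * ((sStar (hdual k) n : ℝ) : ℂ) * cbinom z n)
        (F k) atTop K) ∧
    (∀ z : ℂ, z.re < -(ρ : ℝ) →
      ¬ ∃ L : ℂ, Tendsto
        (fun N => ∑ n ∈ Finset.Icc 1 N,
          (-1 : ℂ) ^ (n - 1) * ((sStar (hdual k) n : ℝ) : ℂ) * cbinom z n)
        atTop (𝓝 L)) := by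
  have hl := hdual_pos k hk hpos
  simp only [sum_Icc_newton_eq_sum_range]
  refine ⟨fun K hK hKsub => ?_, fun z hz ⟨L, hL⟩ =>
    not_tendsto_newton _ ρ hρ hl z hz L hL⟩
  rcases K.eq_empty_or_nonempty with rfl | hne
  · exact tendstoUniformlyOn_empty
  obtain ⟨z₀, hz₀, hmin⟩ := hK.exists_isMinOn hne Complex.continuous_re.continuousOn
  obtain ⟨R, hR⟩ := hK.isBounded.exists_norm_le
  have hδ : 0 < z₀.re + ρ := by
    have : -(ρ : ℝ) < z₀.re := hKsub hz₀
    linarith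
  have hF : F k = fun z => ∑' n : ℕ,
      (-1 : ℂ) ^ n * ((sStar (hdual k) (n + 1) : ℝ) : ℂ) * cbinom z (n + 1) := by
    funext z
    rw [F, if_neg hk]
  rw [hF]
  refine tendstoUniformlyOn_tsum_nat (Summable.mul_left _ ?_) fun n z hz =>
    norm_newton_term_le _ ρ hρ hl (z₀.re + ρ) R hδ z (hR z hz) ?_ n
  · have h := (summable_nat_add_iff 1).mpr (Real.summable_nat_rpow.mpr
      (show -1 - (z₀.re + ρ) / 2 < -1 by linarith))
    simpa using h
  · have : z₀.re ≤ z.re := hmin hz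
    linarith

end Kawashima
end
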